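/- arXiv:2511.22707 — 2 statements merged into one kernel-verified Lean document; each statement's English description precedes it below -/
import Mathlib

section
/- Let K ≥ 2 be an integer, let V ≥ 2 be an integer, and let p be a real number with 1/V < p < 1. Then the expected dissimilarity under hierarchical decoding is strictly smaller than under independent decoding: K − Σ_{k=1}^{K} p^k < (K − Σ_{k=1}^{K} (1/V)^k) · (1 − p^K)/(1 − (1/V)^K). -/
theorem pow_mul_pow_lt_pow_mul_pow_of_lt {p q : ℝ} (hq : 0 < q) (hqp : q < p) {i m : ℕ}
    (him : i < m) : p ^ i * q ^ m < q ^ i * p ^ m := by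
  obtain ⟨d, rfl⟩ := Nat.exists_eq_add_of_lt him
  have hp : 0 < p := hq.trans hqp
  have h : q ^ (d + 1) < p ^ (d + 1) := pow_lt_pow_left₀ hqp hq.le (by omega)
  have h' := mul_lt_mul_of_pos_left h (mul_pos (pow_pos hp i) (pow_pos hq i))
  calc p ^ i * q ^ (i + d + 1) = p ^ i * q ^ i * q ^ (d + 1) := by ring
    _ < p ^ i * q ^ i * p ^ (d + 1) := h'
    _ = q ^ i * p ^ (i + d + 1) := by ring

theorem geom_sum_mul_geom_sum_lt {p q : ℝ} (hq : 0 < q) (hqp : q < p) {k m : ℕ}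
    (hk : 0 < k) (hkm : k < m) :
    (∑ i ∈ Finset.range k, p ^ i) * ∑ i ∈ Finset.range m, q ^ i <
      (∑ i ∈ Finset.range k, q ^ i) * ∑ i ∈ Finset.range m, p ^ i := by
  have step : ∀ n, k ≤ n → (∑ i ∈ Finset.range k, p ^ i) * q ^ n <
      (∑ i ∈ Finset.range k, q ^ i) * p ^ n := by
    intro n hn
    rw [Finset.sum_mul, Finset.sum_mul]
    refine Finset.sum_lt_sum_of_nonempty (Finset.nonempty_range_iff.2 hk.ne') fun i hi => ?_
    exact pow_mul_pow_lt_pow_mul_pow_of_lt hq hqp ((Finset.mem_range.1 hi).trans_le hn)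
  induction m, hkm using Nat.le_induction with
  | base =>
    rw [Finset.sum_range_succ, Finset.sum_range_succ]
    linarith [step k le_rfl]
  | succ n hn ih =>
    rw [Finset.sum_range_succ _ n, Finset.sum_range_succ _ n]
    linarith [step n (Nat.le_of_succ_le hn)]

theorem one_sub_pow_mul_one_sub_pow_lt {p q : ℝ} (hq : 0 < q) (hqp : q < p) (hp : p < 1)
    {k m : ℕ} (hk : 0 < k) (hkm : k < m) :
    (1 - p ^ k) * (1 - q ^ m) < (1 - q ^ k) * (1 - p ^ m) := by
  have h := mul_lt_mul_of_pos_left (geom_sum_mul_geom_sum_lt hq hqp hk hkm)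
    (mul_pos (sub_pos.2 hp) (sub_pos.2 (hqp.trans hp)))
  simp only [← mul_neg_geom_sum]
  linarith

theorem hierarchical_lt_independent (K V : ℕ) (hK : 2 ≤ K) (hV : 2 ≤ V)
    (p : ℝ) (hp1 : 1 / (V : ℝ) < p) (hp2 : p < 1) :
    (K : ℝ) - ∑ k ∈ Finset.Icc 1 K, p ^ k <
      ((K : ℝ) - ∑ k ∈ Finset.Icc 1 K, (1 / (V : ℝ)) ^ k) *
        (1 - p ^ K) / (1 - (1 / (V : ℝ)) ^ K) := by
  have hq : 0 < 1 / (V : ℝ) := one_div_pos.2 (Nat.cast_pos.2 (by omega))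
  generalize 1 / (V : ℝ) = q at hp1 hq ⊢
  have expand (x : ℝ) : (K : ℝ) - ∑ k ∈ Finset.Icc 1 K, x ^ k =
      ∑ k ∈ Finset.Icc 1 K, (1 - x ^ k) := by
    simp [Finset.sum_sub_distrib]
  have hqK : q ^ K < 1 := pow_lt_one₀ hq.le (hp1.trans hp2) (by omega)
  rw [lt_div_iff₀ (sub_pos.2 hqK), expand, expand, Finset.sum_mul, Finset.sum_mul]
  refine Finset.sum_lt_sum (fun k hk => ?_) ⟨1, Finset.mem_Icc.2 ⟨le_rfl, by omega⟩, ?_⟩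
  · obtain ⟨hk1, hkK⟩ := Finset.mem_Icc.1 hk
    obtain rfl | hlt := hkK.eq_or_lt
    · exact (mul_comm _ _).le
    · exact (one_sub_pow_mul_one_sub_pow_lt hq hp1 hp2 hk1 hlt).le
  · exact one_sub_pow_mul_one_sub_pow_lt hq hp1 hp2 one_pos (by omega)
end

section
/- Let K ≥ 2 be an integer. The function ψ defined by ψ(p) = (K − Σ_{k=1}^{K} p^k)/(1 − p^K) is strictly decreasing on the interval [0,1): for all real numbers p, q with 0 ≤ p < q < 1, one has ψ(q) < ψ(p). -/
theorem pow_mul_pow_le_pow_mul_pow {p q : ℝ} (hp : 0 ≤ p) (hpq : p ≤ q) {i j : ℕ} (hij : i ≤ j) :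
    q ^ i * p ^ j ≤ p ^ i * q ^ j := by
  obtain ⟨d, rfl⟩ := Nat.exists_eq_add_of_le hij
  have hq : 0 ≤ q := hp.trans hpq
  calc q ^ i * p ^ (i + d) = p ^ i * q ^ i * p ^ d := by ring
    _ ≤ p ^ i * q ^ i * q ^ d := by gcongr
    _ = p ^ i * q ^ (i + d) := by ring

theorem geom_sum_mul_geom_sum_le {p q : ℝ} (hp : 0 ≤ p) (hpq : p ≤ q) {k n : ℕ} (hkn : k ≤ n) :
    (∑ i ∈ Finset.range k, q ^ i) * ∑ j ∈ Finset.range n, p ^ j ≤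
      (∑ i ∈ Finset.range k, p ^ i) * ∑ j ∈ Finset.range n, q ^ j := by
  induction n, hkn using Nat.le_induction with
  | base => rw [mul_comm]
  | succ n hkn ih =>
    rw [Finset.sum_range_succ, Finset.sum_range_succ _ n, mul_add, mul_add]
    refine add_le_add ih ?_
    rw [Finset.sum_mul, Finset.sum_mul]
    exact Finset.sum_le_sum fun i hi =>
      pow_mul_pow_le_pow_mul_pow hp hpq ((Finset.mem_range.1 hi).le.trans hkn)

theorem one_sub_pow_mul_one_sub_pow_le {p q : ℝ} (hp : 0 ≤ p) (hpq : p ≤ q) (hq : q ≤ 1)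
    {k n : ℕ} (hkn : k ≤ n) :
    (1 - q ^ k) * (1 - p ^ n) ≤ (1 - p ^ k) * (1 - q ^ n) := by
  have h : 0 ≤ (1 - p) * (1 - q) := mul_nonneg (by linarith) (by linarith)
  have := mul_le_mul_of_nonneg_left (geom_sum_mul_geom_sum_le hp hpq hkn) h
  simp only [← mul_neg_geom_sum]
  linarith

theorem one_sub_mul_one_sub_pow_lt {p q : ℝ} (hp : 0 ≤ p) (hpq : p < q) (hq : q < 1)
    {n : ℕ} (hn : 2 ≤ n) :
    (1 - q) * (1 - p ^ n) < (1 - p) * (1 - q ^ n) := by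
  have h : 0 < (1 - p) * (1 - q) := mul_pos (by linarith) (by linarith)
  have hsum : ∑ i ∈ Finset.range n, p ^ i < ∑ i ∈ Finset.range n, q ^ i :=
    Finset.sum_lt_sum (fun i _ => pow_le_pow_left₀ hp hpq.le i)
      ⟨1, Finset.mem_range.2 hn, by simpa using hpq⟩
  have := mul_lt_mul_of_pos_left hsum h
  simp only [← mul_neg_geom_sum]
  linarith

theorem psi_strictAnti (K : ℕ) (hK : 2 ≤ K) (p q : ℝ)
    (hp : 0 ≤ p) (hpq : p < q) (hq : q < 1) :
    ((K : ℝ) - ∑ k ∈ Finset.Icc 1 K, q ^ k) / (1 - q ^ K) <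
      ((K : ℝ) - ∑ k ∈ Finset.Icc 1 K, p ^ k) / (1 - p ^ K) := by
  have hK0 : K ≠ 0 := by omega
  have hpK : 0 < 1 - p ^ K := sub_pos.2 (pow_lt_one₀ hp (hpq.trans hq) hK0)
  have hqK : 0 < 1 - q ^ K := sub_pos.2 (pow_lt_one₀ (hp.trans hpq.le) hq hK0)
  have hnum (x : ℝ) :
      (K : ℝ) - ∑ k ∈ Finset.Icc 1 K, x ^ k = ∑ k ∈ Finset.Icc 1 K, (1 - x ^ k) := by
    simp [Finset.sum_sub_distrib]
  rw [hnum, hnum, div_lt_div_iff₀ hqK hpK, Finset.sum_mul, Finset.sum_mul]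
  refine Finset.sum_lt_sum
    (fun k hk => one_sub_pow_mul_one_sub_pow_le hp hpq.le hq.le (Finset.mem_Icc.1 hk).2)
    ⟨1, Finset.mem_Icc.2 ⟨le_rfl, by omega⟩, ?_⟩
  simpa only [pow_one] using one_sub_mul_one_sub_pow_lt hp hpq hq hK
end
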